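/- arXiv:2109.06071 — 10 statements merged into one kernel-verified Lean document; each statement's English description precedes it below -/
import Mathlib

section
/- If an open graph (G,S,T) admits a causal flow, then it admits a focused gFlow. -/
/-- A causal flow on the open graph `(G, S, T)`: a function `f` (relevant on `V ∖ T`,
taking values outside `S`) together with a strict partial order `r` such that for every
`v ∉ T`: `f v` is adjacent to `v`, `v ≺ f v`, and every `u ≠ v` adjacent to `f v`
satisfies `v ≺ u`. -/
def HasCausalFlow {V : Type*} (G : SimpleGraph V) (S T : Set V) : Prop :=
  ∃ (f : V → V) (r : V → V → Prop),
    IsStrictOrder V r ∧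
    (∀ v, v ∉ T → f v ∉ S) ∧
    (∀ v, v ∉ T → G.Adj (f v) v ∧ r v (f v) ∧
      ∀ u, G.Adj u (f v) → u ≠ v → r v u)

/-- The odd neighbourhood of a set `A`: vertices having an odd number of neighbours in `A`. -/
def oddNbhd {V : Type*} (G : SimpleGraph V) (A : Set V) : Set V :=
  {v | Odd ((G.neighborSet v) ∩ A).ncard}

/-- A focused gFlow on the open graph `(G, S, T)`: a function `g` (relevant on `V ∖ T`,
taking values in subsets of `V ∖ S`) together with a strict partial order `r` such that
for every `u ∉ T`: `Odd_G(g u) ∩ Tᶜ = {u}` and `u ≺ v` for every `v ∈ g u`. -/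
def HasFocusedGFlow {V : Type*} (G : SimpleGraph V) (S T : Set V) : Prop :=
  ∃ (g : V → Set V) (r : V → V → Prop),
    IsStrictOrder V r ∧
    ∀ u, u ∉ T →
      g u ⊆ Sᶜ ∧ oddNbhd G (g u) ∩ Tᶜ = {u} ∧ ∀ v ∈ g u, r u v

open Classical in
/-- Membership in the odd neighbourhood of the support of a vector over `ZMod 2`, in terms of the
adjacency matrix. -/
theorem mem_oddNbhd_support_iff {V : Type*} [Fintype V] (G : SimpleGraph V) (x : V → ZMod 2)
    (w : V) :
    w ∈ oddNbhd G {v | x v ≠ 0} ↔ ∑ v, (if G.Adj w v then x v else 0) = 1 := by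
  have hx : ∀ v, x v = if x v ≠ 0 then 1 else 0 := by
    intro v
    generalize x v = a
    revert a
    decide
  have hcard : (G.neighborSet w ∩ {v | x v ≠ 0}).ncard =
      (Finset.univ.filter fun v => G.Adj w v ∧ x v ≠ 0).card := by
    rw [← Set.ncard_coe_finset]
    congr 1
    ext v
    simp
  have hsum : ∑ v, (if G.Adj w v then x v else 0) =
      (((G.neighborSet w ∩ {v | x v ≠ 0}).ncard : ℕ) : ZMod 2) := by
    rw [hcard, Finset.natCast_card_filter]
    refine Finset.sum_congr rfl fun v _ => ?_
    rw [ite_and, ← hx v]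
  rw [hsum, ZMod.natCast_eq_one_iff_odd]
  rfl

open Classical in
/-- Along a causal flow, every basis vector at a non-sink is, on the non-sinks, the image under
the adjacency matrix over `ZMod 2` of a vector supported on later non-sources. -/
theorem exists_focused_vector {V : Type*} [Fintype V] {G : SimpleGraph V} {S T : Set V}
    {f : V → V} {r : V → V → Prop} [IsStrictOrder V r]
    (hS : ∀ v, v ∉ T → f v ∉ S)
    (hf : ∀ v, v ∉ T → G.Adj (f v) v ∧ r v (f v) ∧ ∀ u, G.Adj u (f v) → u ≠ v → r v u)
    (u : V) (hu : u ∉ T) :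
    ∃ x : V → ZMod 2, (∀ v, x v ≠ 0 → v ∉ S ∧ r u v) ∧
      ∀ w, w ∉ T → ∑ v, (if G.Adj w v then x v else 0) = if w = u then 1 else 0 := by
  induction u using (Finite.wellFounded_of_trans_of_irrefl (Function.swap r)).induction with
  | _ u ih =>
  obtain ⟨hadj, hlt, hnb⟩ := hf u hu
  let N := Finset.univ.filter fun w => w ∉ T ∧ G.Adj w (f u) ∧ w ≠ u
  have hN : ∀ w : V, ∃ x : V → ZMod 2, w ∈ N → (∀ v, x v ≠ 0 → v ∉ S ∧ r w v) ∧
      ∀ z, z ∉ T → ∑ v, (if G.Adj z v then x v else 0) = if z = w then 1 else 0 := by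
    intro w
    by_cases hw : w ∈ N
    · obtain ⟨hwT, hwa, hwu⟩ := (Finset.mem_filter.mp hw).2
      obtain ⟨x, hx⟩ := ih w (hnb w hwa hwu) hwT
      exact ⟨x, fun _ => hx⟩
    · exact ⟨0, fun h => absurd h hw⟩
  choose y hy using hN
  refine ⟨fun v => (if v = f u then 1 else 0) - ∑ w ∈ N, y w v, fun v hv => ?_, fun z hz => ?_⟩
  · by_cases hvf : v = f u
    · exact hvf ▸ ⟨hS u hu, hlt⟩
    · have hne : ∑ w ∈ N, y w v ≠ 0 := by
        intro h
        simp [hvf, h] at hv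
      obtain ⟨w, hw, hwv⟩ := Finset.exists_ne_zero_of_sum_ne_zero hne
      obtain ⟨hvS, hwr⟩ := (hy w hw).1 v hwv
      obtain ⟨-, hwa, hwu⟩ := (Finset.mem_filter.mp hw).2
      exact ⟨hvS, _root_.trans (hnb w hwa hwu) hwr⟩
  · have hsplit : ∀ v, (if G.Adj z v then (if v = f u then 1 else 0) - ∑ w ∈ N, y w v else 0) =
        (if v = f u then (if G.Adj z v then (1 : ZMod 2) else 0) else 0) -
          ∑ w ∈ N, if G.Adj z v then y w v else 0 := by
      intro v
      by_cases h : G.Adj z v <;> simp [h]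
    rw [Finset.sum_congr rfl fun v _ => hsplit v, Finset.sum_sub_distrib, Finset.sum_comm,
      Finset.sum_congr rfl fun w hw => (hy w hw).2 z hz, Finset.sum_ite_eq', Finset.sum_ite_eq]
    by_cases hzu : z = u
    · subst hzu
      simp [N, hadj.symm]
    · by_cases hza : G.Adj z (f u) <;> simp [N, hz, hzu, hza]

/-- If an open graph admits a causal flow, then it admits a focused gFlow. -/
theorem causalFlow_to_focusedGFlow {V : Type*} [Finite V]
    (G : SimpleGraph V) (S T : Set V)
    (h : HasCausalFlow G S T) : HasFocusedGFlow G S T := by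
  classical
  have := Fintype.ofFinite V
  obtain ⟨f, r, hr, hS, hf⟩ := h
  choose! x hx using exists_focused_vector hS hf
  refine ⟨fun u => {v | x u v ≠ 0}, r, hr, fun u hu => ⟨fun v hv => ((hx u hu).1 v hv).1, ?_,
    fun v hv => ((hx u hu).1 v hv).2⟩⟩
  ext w
  rw [Set.mem_inter_iff, mem_oddNbhd_support_iff, Set.mem_compl_iff, Set.mem_singleton_iff]
  constructor
  · rintro ⟨hw, hwT⟩
    by_contra hwu
    simp [(hx u hu).2 w hwT, hwu] at hw
  · rintro rfl
    exact ⟨by simpa using (hx w hu).2 w hu, hu⟩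
end

section
/- Let (G,S,T) be an open graph admitting a causal flow and let v ∈ S. Let G' be the graph obtained from G by adding two new vertices a and b together with the edges {a,b} and {b,v}, and let S' = (S∖{v}) ∪ {a}. Then the open graph (G',S',T) admits a causal flow. -/
/-- The graph `G` extended with two fresh vertices `a = Sum.inr false` and
`b = Sum.inr true`, together with the edges `{a, b}` and `{b, v}`. -/
def addInputPair {V : Type*} (G : SimpleGraph V) (v : V) : SimpleGraph (V ⊕ Bool) :=
  SimpleGraph.fromRel (fun x y =>
    (∃ a b, x = Sum.inl a ∧ y = Sum.inl b ∧ G.Adj a b) ∨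
    (x = Sum.inr false ∧ y = Sum.inr true) ∨
    (x = Sum.inr true ∧ y = Sum.inl v))

namespace addInputPair

variable {V : Type*} {G : SimpleGraph V} {v : V}

@[simp]
theorem adj_inl_inl {x y : V} :
    (addInputPair G v).Adj (Sum.inl x) (Sum.inl y) ↔ G.Adj x y := by
  simp only [addInputPair, SimpleGraph.fromRel_adj]
  have := G.adj_comm x y
  have := @SimpleGraph.Adj.ne _ G x y
  aesop

@[simp]
theorem adj_inr_inl {p : Bool} {x : V} :
    (addInputPair G v).Adj (Sum.inr p) (Sum.inl x) ↔ p = true ∧ x = v := by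
  simp [addInputPair, SimpleGraph.fromRel_adj]

@[simp]
theorem adj_inl_inr {p : Bool} {x : V} :
    (addInputPair G v).Adj (Sum.inl x) (Sum.inr p) ↔ p = true ∧ x = v := by
  rw [SimpleGraph.adj_comm, adj_inr_inl]

@[simp]
theorem adj_inr_inr {p q : Bool} :
    (addInputPair G v).Adj (Sum.inr p) (Sum.inr q) ↔ p ≠ q := by
  cases p <;> cases q <;> simp [addInputPair, SimpleGraph.fromRel_adj]

/-- Send `a` to `b`, `b` to `v`, and act as `f` on the old vertices. -/
def successor (f : V → V) (v : V) : V ⊕ Bool → V ⊕ Bool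
  | Sum.inl x => Sum.inl (f x)
  | Sum.inr false => Sum.inr true
  | Sum.inr true => Sum.inl v

/-- The order `a < b` placed below the relation `r` on the old vertices. -/
def before (r : V → V → Prop) : V ⊕ Bool → V ⊕ Bool → Prop
  | Sum.inl x, Sum.inl y => r x y
  | Sum.inl _, Sum.inr _ => False
  | Sum.inr _, Sum.inl _ => True
  | Sum.inr p, Sum.inr q => p < q

theorem isStrictOrder_before {r : V → V → Prop} (hr : IsStrictOrder V r) :
    IsStrictOrder (V ⊕ Bool) (before r) where
  irrefl x := by
    cases x with
    | inl x => exact hr.irrefl x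
    | inr p => exact lt_irrefl p
  trans x y z := by
    rcases x with x | p <;> rcases y with y | q <;> rcases z with z | s <;>
      simp only [before, false_implies, implies_true]
    · exact hr.trans x y z
    · exact lt_trans

end addInputPair

/-- Extending an open graph with a causal flow by a fresh path `a - b - v` at a source
`v ∈ S`, and replacing `v` by `a` in the source set, preserves admittance of a causal flow. -/
theorem addInputPair_hasCausalFlow {V : Type*} [Finite V]
    (G : SimpleGraph V) (S T : Set V) (v : V) (hv : v ∈ S)
    (h : HasCausalFlow G S T) :
    HasCausalFlow (addInputPair G v)
      (Sum.inl '' (S \ {v}) ∪ {Sum.inr false}) (Sum.inl '' T) := by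
  obtain ⟨f, r, hr, hS, hT⟩ := h
  refine ⟨addInputPair.successor f v, addInputPair.before r,
    addInputPair.isStrictOrder_before hr, ?_, ?_⟩
  · rintro (x | _ | _) hx
    · have := hS x (by simpa using hx)
      simp [addInputPair.successor, this]
    · simp [addInputPair.successor]
    · simp [addInputPair.successor]
  · rintro (x | _ | _) hx
    · have hxT : x ∉ T := by simpa using hx
      obtain ⟨hadj, hlt, hnbr⟩ := hT x hxT
      have hne : f x ≠ v := fun h => hS x hxT (h ▸ hv)
      refine ⟨by simpa [addInputPair.successor], hlt, ?_⟩
      rintro (u | p) hu hux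
      · exact hnbr u (by simpa [addInputPair.successor] using hu) (by simpa using hux)
      · simp [addInputPair.successor, hne] at hu
    · refine ⟨by simp [addInputPair.successor],
        by simp [addInputPair.successor, addInputPair.before], ?_⟩
      rintro (u | _ | _) <;> simp [addInputPair.successor, addInputPair.before]
    · refine ⟨by simp [addInputPair.successor], trivial, ?_⟩
      rintro (u | _ | _) <;> simp [addInputPair.successor, addInputPair.before]
end

section
/- Let (G,S,T) be an open graph admitting a causal flow and let v ∈ T with v ∉ S. Let G' be the graph obtained from G by adding two new vertices c and d together with the edges {v,c} and {c,d}, and let T' = (T∖{v}) ∪ {d}. Then the open graph (G',S,T') admits a causal flow. -/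
/-- The graph `G` extended with two fresh vertices `c = Sum.inr false` and
`d = Sum.inr true`, together with the edges `{v, c}` and `{c, d}`. -/
def addOutputPair {V : Type*} (G : SimpleGraph V) (v : V) : SimpleGraph (V ⊕ Bool) :=
  SimpleGraph.fromRel (fun x y =>
    (∃ a b, x = Sum.inl a ∧ y = Sum.inl b ∧ G.Adj a b) ∨
    (x = Sum.inl v ∧ y = Sum.inr false) ∨
    (x = Sum.inr false ∧ y = Sum.inr true))

theorem Sum.Lex.isStrictOrder {α β : Type*} {r : α → α → Prop} {s : β → β → Prop}
    (hr : IsStrictOrder α r) (hs : IsStrictOrder β s) :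
    IsStrictOrder (α ⊕ β) (Sum.Lex r s) where
  irrefl
    | .inl a, h => hr.irrefl a (Sum.lex_inl_inl.1 h)
    | .inr b, h => hs.irrefl b (Sum.lex_inr_inr.1 h)
  trans
    | _, _, _, .inl h, .inl h' => .inl (hr.trans _ _ _ h h')
    | _, _, _, .inl _, .sep _ _ => .sep _ _
    | _, _, _, .sep _ _, .inr _ => .sep _ _
    | _, _, _, .inr h, .inr h' => .inr (hs.trans _ _ _ h h')

section addOutputPair

variable {V : Type*} (G : SimpleGraph V) (v : V)

theorem addOutputPair_adj_inl_inl (a b : V) :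
    (addOutputPair G v).Adj (Sum.inl a) (Sum.inl b) ↔ G.Adj a b := by
  simp only [addOutputPair, SimpleGraph.fromRel_adj]
  have := G.adj_comm a b
  have := G.ne_of_adj (a := a) (b := b)
  simp
  tauto

theorem addOutputPair_adj_inl_false (a : V) :
    (addOutputPair G v).Adj (Sum.inl a) (Sum.inr false) ↔ a = v := by
  simp [addOutputPair]

theorem not_addOutputPair_adj_inl_true (a : V) :
    ¬ (addOutputPair G v).Adj (Sum.inl a) (Sum.inr true) := by
  simp [addOutputPair]

theorem addOutputPair_adj_true_false :
    (addOutputPair G v).Adj (Sum.inr true) (Sum.inr false) := by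
  simp [addOutputPair]

end addOutputPair

/-- Extending an open graph with a causal flow by a fresh path `v - c - d` at a sink
`v ∈ T ∖ S`, and replacing `v` by `d` in the sink set, preserves admittance of a
causal flow. -/
theorem addOutputPair_hasCausalFlow {V : Type*} [Finite V]
    (G : SimpleGraph V) (S T : Set V) (v : V) (hvT : v ∈ T) (hvS : v ∉ S)
    (h : HasCausalFlow G S T) :
    HasCausalFlow (addOutputPair G v)
      (Sum.inl '' S) (Sum.inl '' (T \ {v}) ∪ {Sum.inr true}) := by
  classical
  obtain ⟨f, r, hr, hS, hf⟩ := h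
  refine ⟨Sum.elim (fun x => if x = v then Sum.inr false else Sum.inl (f x))
    (fun _ => Sum.inr true), Sum.Lex r (· < ·),
    Sum.Lex.isStrictOrder hr inferInstance, ?_, ?_⟩
  · rintro (x | b) hx
    · by_cases hxv : x = v
      · simp [hxv]
      · have hxT : x ∉ T := fun hT => hx (Or.inl ⟨x, ⟨hT, hxv⟩, rfl⟩)
        simpa [hxv] using hS x hxT
    · simp
  · rintro (x | _ | _) hx
    · by_cases hxv : x = v
      · subst hxv
        simp only [Sum.elim_inl, if_true]
        refine ⟨((addOutputPair_adj_inl_false G x x).2 rfl).symm, .sep _ _, ?_⟩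
        rintro (u | b) hu hne
        · exact absurd (congrArg Sum.inl ((addOutputPair_adj_inl_false G x u).1 hu)) hne
        · exact .sep _ _
      · have hxT : x ∉ T := fun hT => hx (Or.inl ⟨x, ⟨hT, hxv⟩, rfl⟩)
        obtain ⟨hadj, hlt, hnbr⟩ := hf x hxT
        simp only [Sum.elim_inl, if_neg hxv]
        refine ⟨(addOutputPair_adj_inl_inl G v _ _).2 hadj, .inl hlt, ?_⟩
        rintro (u | b) hu hne
        · exact .inl (hnbr u ((addOutputPair_adj_inl_inl G v _ _).1 hu)
            fun h => hne (congrArg Sum.inl h))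
        · exact .sep _ _
    · refine ⟨addOutputPair_adj_true_false G v, .inr (by decide), ?_⟩
      rintro (u | _ | _) hu hne
      · exact absurd hu (not_addOutputPair_adj_inl_true G v u)
      · exact absurd rfl hne
      · exact absurd hu ((addOutputPair G v).loopless.irrefl _)
    · exact absurd (Or.inr rfl) hx
end

section
/- Let (G,S,T) be an open graph admitting a focused gFlow and let u be a vertex with u ∉ S ∪ T. Then the open graph ((G⋆u) − u, S, T), obtained by locally complementing G at u and then deleting u, admits a focused gFlow. -/
/-- Local complementation of `G` at `u`: adjacency between distinct neighbours of `u`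
is toggled, all other adjacencies are unchanged. -/
def localComp {V : Type*} (G : SimpleGraph V) (u : V) : SimpleGraph V :=
  SimpleGraph.fromRel (fun x y =>
    (G.Adj u x ∧ G.Adj u y ∧ ¬ G.Adj x y) ∨ (¬(G.Adj u x ∧ G.Adj u y) ∧ G.Adj x y))

open scoped Classical in
/-- The adjacency indicator of `G` with values in `ZMod 2`. -/
noncomputable def adjInd {V : Type*} (G : SimpleGraph V) (x y : V) : ZMod 2 :=
  if G.Adj x y then 1 else 0

open scoped Classical in
theorem adjInd_comm {V : Type*} (G : SimpleGraph V) (x y : V) :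
    adjInd G x y = adjInd G y x :=
  if_congr (G.adj_comm x y) rfl rfl

open scoped Classical in
theorem mem_oddNbhd_iff {V : Type*} [Fintype V] (G : SimpleGraph V) (A : Set V) (v : V) :
    v ∈ oddNbhd G A ↔ ∑ w, adjInd G v w * (if w ∈ A then 1 else 0) = 1 := by
  have hsum : ∑ w, adjInd G v w * (if w ∈ A then 1 else 0)
      = (((G.neighborSet v) ∩ A).ncard : ZMod 2) := by
    rw [Set.ncard_eq_toFinset_card', Finset.card_eq_sum_ones, Nat.cast_sum]
    simp only [Nat.cast_one, adjInd, ← ite_and, mul_ite, mul_one, mul_zero]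
    rw [← Finset.sum_filter]
    refine Finset.sum_congr ?_ fun _ _ => rfl
    ext w
    simp [and_comm]
  rw [hsum, ZMod.natCast_eq_one_iff_odd]
  rfl

open scoped Classical in
theorem adjInd_localComp {V : Type*} (G : SimpleGraph V) (u x y : V) :
    adjInd (localComp G u) x y = adjInd G x y + adjInd G u x * adjInd G u y
      + if x = y then adjInd G u x else 0 := by
  have h2 : (1 + 1 : ZMod 2) = 0 := by decide
  by_cases hxy : x = y
  · subst hxy
    by_cases hx : G.Adj u x <;> simp [adjInd, localComp, hx, h2]
  · by_cases h : G.Adj x y <;> by_cases hx : G.Adj u x <;> by_cases hy : G.Adj u y <;>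
      simp [adjInd, localComp, hxy, h, G.adj_comm y x, hx, hy, h2]

open scoped Classical in
theorem oddNbhd_inter_compl_eq_singleton_iff {V : Type*} [Fintype V] (G : SimpleGraph V)
    (A T : Set V) {v : V} (hv : v ∉ T) :
    oddNbhd G A ∩ Tᶜ = {v} ↔ ∀ x ∉ T,
      ∑ w, adjInd G x w * (if w ∈ A then 1 else 0) = if x = v then 1 else 0 := by
  have h01 : ∀ a : ZMod 2, a ≠ 1 ↔ a = 0 := by decide
  constructor
  · intro h x hx
    have hmem := Set.ext_iff.1 h x
    simp only [Set.mem_inter_iff, mem_oddNbhd_iff, Set.mem_compl_iff, hx, not_false_eq_true,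
      and_true, Set.mem_singleton_iff] at hmem
    split_ifs with hxv
    · exact hmem.2 hxv
    · exact (h01 _).1 fun h1 => hxv (hmem.1 h1)
  · intro h
    ext x
    simp only [Set.mem_inter_iff, mem_oddNbhd_iff, Set.mem_compl_iff, Set.mem_singleton_iff]
    constructor
    · rintro ⟨h1, hx⟩
      by_contra hxv
      rw [h x hx, if_neg hxv] at h1
      exact zero_ne_one h1
    · rintro rfl
      exact ⟨by rw [h x hv, if_pos rfl], hv⟩

open scoped Classical in
/-- Given a right inverse `γ` of the adjacency matrix on the non-sinks, supported above the
diagonal of `r`, one obtains such a right inverse for the locally complemented graph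
without `u`. -/
theorem exists_correction_localComp {V : Type*} [Fintype V] (G : SimpleGraph V) (S T : Set V)
    (u : V) (huT : u ∉ T) (r : V → V → Prop) [IsStrictOrder V r] (γ : V → V → ZMod 2)
    (hS : ∀ v ∉ T, ∀ w ∈ S, γ v w = 0) (hr : ∀ v ∉ T, ∀ w, γ v w ≠ 0 → r v w)
    (hγ : ∀ v ∉ T, ∀ x ∉ T, ∑ w, adjInd G x w * γ v w = if x = v then 1 else 0)
    (v : V) (hvT : v ∉ T) (hvu : v ≠ u) :
    ∃ f : V → ZMod 2, f u = 0 ∧ (∀ w ∈ S, f w = 0) ∧ (∀ w, f w ≠ 0 → r v w) ∧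
      ∀ x ∉ T, x ≠ u →
        ∑ w, adjInd (localComp G u) x w * f w = if x = v then 1 else 0 := by
  have hwf : WellFounded (Function.swap r) :=
    Finite.wellFounded_of_trans_of_irrefl _
  induction v using hwf.induction with
  | _ v ih =>
  have ih' : ∀ w, ∃ f : V → ZMod 2, r v w → w ∉ T → w ≠ u →
      f u = 0 ∧ (∀ y ∈ S, f y = 0) ∧ (∀ y, f y ≠ 0 → r w y) ∧
      ∀ x ∉ T, x ≠ u →
        ∑ y, adjInd (localComp G u) x y * f y = if x = w then 1 else 0 := by
    intro w
    by_cases hw : r v w ∧ w ∉ T ∧ w ≠ u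
    · obtain ⟨f, hf⟩ := ih w hw.1 hw.2.1 hw.2.2
      exact ⟨f, fun _ _ _ => hf⟩
    · exact ⟨0, fun h1 h2 h3 => absurd ⟨h1, h2, h3⟩ hw⟩
  choose h hh using ih'
  have h2 : ∀ a : ZMod 2, a + a = 0 := by decide
  have huu : γ u u = 0 := by
    by_contra hne
    exact irrefl u (hr u huT u hne)
  set X : V → ZMod 2 := fun w => if w = u then 0 else γ v w + γ v u * γ u w with hX
  have hXu : X u = 0 := if_pos rfl
  have hXS : ∀ w ∈ S, X w = 0 := fun w hw => by
    simp [hX, hS v hvT w hw, hS u huT w hw]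
  have hXr : ∀ w, X w ≠ 0 → r v w := by
    intro w hw
    by_contra hvw
    apply hw
    have h1 : γ v w = 0 := by_contra fun hne => hvw (hr v hvT w hne)
    have h3 : γ v u * γ u w = 0 := by
      by_contra hne
      exact hvw (_root_.trans (hr v hvT u (left_ne_zero_of_mul hne))
        (hr u huT w (right_ne_zero_of_mul hne)))
    simp [hX, h1, h3]
  have hXsum : ∀ x ∉ T, ∑ w, adjInd G x w * X w =
      (if x = v then 1 else 0) + γ v u * (if x = u then 1 else 0) + adjInd G x u * γ v u := by
    intro x hx
    have hterm : ∀ w, adjInd G x w * X w = adjInd G x w * γ v w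
        + γ v u * (adjInd G x w * γ u w) + if w = u then adjInd G x u * γ v u else 0 := by
      intro w
      by_cases hw : w = u
      · subst hw
        simp [hX, huu, h2]
      · simp only [hX, if_neg hw]
        ring
    simp only [hterm, Finset.sum_add_distrib, ← Finset.mul_sum, hγ v hvT x hx, hγ u huT x hx,
      Finset.sum_ite_eq', Finset.mem_univ, if_true]
  have hXloc : ∀ x ∉ T, x ≠ u → ∑ w, adjInd (localComp G u) x w * X w =
      (if x = v then 1 else 0) + adjInd G u x * X x := by
    intro x hx hxu
    simp only [adjInd_localComp, add_mul, Finset.sum_add_distrib, mul_assoc, ← Finset.mul_sum,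
      hXsum x hx, hXsum u huT, ite_mul, zero_mul, Finset.sum_ite_eq, Finset.mem_univ, if_true,
      if_neg hxu, if_neg hvu.symm]
    have huu' : adjInd G u u = 0 := by simp [adjInd]
    rw [adjInd_comm G x u, huu']
    linear_combination h2 (adjInd G u x * γ v u)
  set c : V → ZMod 2 := fun w => if w ∈ T then 0 else adjInd G u w * X w with hc
  have hcne : ∀ w, c w ≠ 0 → r v w ∧ w ∉ T ∧ w ≠ u := by
    intro w hw
    have hwT : w ∉ T := fun hwT => hw (if_pos hwT)
    have hXw : X w ≠ 0 := by
      simp only [hc, if_neg hwT] at hw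
      exact right_ne_zero_of_mul hw
    exact ⟨hXr w hXw, hwT, fun hwu => hXw (hwu ▸ hXu)⟩
  refine ⟨fun y => X y + ∑ w, c w * h w y, ?_, ?_, ?_, ?_⟩
  · simp only [hXu, zero_add]
    refine Finset.sum_eq_zero fun w _ => ?_
    by_cases hw : c w = 0
    · simp [hw]
    · obtain ⟨h1, h3, h4⟩ := hcne w hw
      simp [(hh w h1 h3 h4).1]
  · intro y hy
    simp only [hXS y hy, zero_add]
    refine Finset.sum_eq_zero fun w _ => ?_
    by_cases hw : c w = 0
    · simp [hw]
    · obtain ⟨h1, h3, h4⟩ := hcne w hw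
      simp [(hh w h1 h3 h4).2.1 y hy]
  · intro y hy
    by_contra hvy
    apply hy
    have hXy : X y = 0 := by_contra fun hne => hvy (hXr y hne)
    simp only [hXy, zero_add]
    refine Finset.sum_eq_zero fun w _ => ?_
    by_contra hne
    obtain ⟨h1, h3, h4⟩ := hcne w (left_ne_zero_of_mul hne)
    exact hvy (_root_.trans h1 ((hh w h1 h3 h4).2.2.1 y (right_ne_zero_of_mul hne)))
  · intro x hx hxu
    have hswap : ∑ y, adjInd (localComp G u) x y * ∑ w, c w * h w y =
        ∑ w, c w * ∑ y, adjInd (localComp G u) x y * h w y := by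
      simp only [Finset.mul_sum]
      rw [Finset.sum_comm]
      exact Finset.sum_congr rfl fun w _ => Finset.sum_congr rfl fun y _ => by ring
    have hterm : ∀ w, c w * ∑ y, adjInd (localComp G u) x y * h w y =
        if x = w then c w else 0 := by
      intro w
      by_cases hw : c w = 0
      · simp [hw]
      · obtain ⟨h1, h3, h4⟩ := hcne w hw
        simp [(hh w h1 h3 h4).2.2.2 x hx hxu]
    simp only [mul_add, Finset.sum_add_distrib, hswap, hterm, hXloc x hx hxu,
      Finset.sum_ite_eq, Finset.mem_univ, if_true]
    simp only [hc, if_neg hx, add_assoc, h2, add_zero]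

/-- Locally complementing at an internal vertex `u ∉ S ∪ T` and then deleting `u`
preserves admittance of a focused gFlow. -/
theorem localComp_delete_hasFocusedGFlow {V : Type*} [Finite V]
    (G : SimpleGraph V) (S T : Set V) (u : V) (hu : u ∉ S ∪ T)
    (h : HasFocusedGFlow G S T) :
    HasFocusedGFlow ((localComp G u).induce {x | x ≠ u})
      (Subtype.val ⁻¹' S) (Subtype.val ⁻¹' T) := by
  classical
  cases nonempty_fintype V
  obtain ⟨g, r, hr, hg⟩ := h
  rw [Set.mem_union, not_or] at hu
  have key := exists_correction_localComp G S T u hu.2 r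
    (fun v w => if w ∈ g v then 1 else 0)
    (fun v hv w hw => if_neg fun hwg => (hg v hv).1 hwg hw)
    (fun v hv w hw => (hg v hv).2.2 w (by_contra fun hwg => hw (if_neg hwg)))
    (fun v hv => (oddNbhd_inter_compl_eq_singleton_iff G (g v) T hv).1 (hg v hv).2.1)
  choose! f hfu hfS hfr hf using key
  have hind : ∀ (p : Prop) (_ : Decidable p) (a : ZMod 2), (p ↔ a ≠ 0) →
      (if p then 1 else 0) = a := by
    intro p _ a hp
    have h01 : a = 0 ∨ a = 1 := by
      clear hp
      decide +revert
    rcases h01 with rfl | rfl <;> simp [hp]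
  refine ⟨fun v => {w | f v w ≠ 0}, fun v w => r v w,
    { irrefl := fun v => irrefl (r := r) v.1
      trans := fun _ _ _ h1 h2 => _root_.trans (r := r) h1 h2 }, fun v hv => ⟨?_, ?_, ?_⟩⟩
  · exact fun w hw hwS => hw (hfS v hv v.2 w hwS)
  · rw [oddNbhd_inter_compl_eq_singleton_iff _ _ _ hv]
    intro x hx
    refine (Finset.sum_congr (g := fun w : {x | x ≠ u} => adjInd (localComp G u) x w * f v w)
      rfl fun w _ => ?_).trans ?_
    · exact congrArg (adjInd (localComp G u) x w * ·) (hind _ _ (f v w) Iff.rfl)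
    simp only [Subtype.ext_iff]
    rw [← hf v hv v.2 x hx x.2]
    rw [← Finset.sum_subset (Finset.subset_univ (Finset.univ.filter (· ≠ u))) fun w _ hw => ?_]
    · exact (Finset.sum_subtype _ (fun w => by simp)
        fun w => adjInd (localComp G u) x w * f v w).symm
    · simp only [Finset.mem_filter, Finset.mem_univ, true_and, not_not] at hw
      rw [hw, hfu v hv v.2, mul_zero]
  · exact fun w hw => hfr v hv v.2 w hw
end

section
/- Let (G,S,T) be an open graph admitting a focused gFlow and let u ∈ T with u ∉ S. Then the open graph (G⋆u, S, T), obtained by locally complementing G at u, admits a focused gFlow. -/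
open scoped symmDiff

theorem Set.odd_ncard_symmDiff {V : Type*} [Finite V] (A B : Set V) :
    Odd (A ∆ B).ncard ↔ ¬ (Odd A.ncard ↔ Odd B.ncard) := by
  have hAB : (A ∆ B).ncard = (A \ B).ncard + (B \ A).ncard :=
    Set.ncard_union_eq disjoint_sdiff_sdiff
  have hA := Set.ncard_inter_add_ncard_sdiff_eq_ncard A B
  have hB := Set.ncard_inter_add_ncard_sdiff_eq_ncard B A
  rw [Set.inter_comm] at hB
  simp only [Nat.odd_iff]
  omega

theorem oddNbhd_symmDiff {V : Type*} [Finite V] (G : SimpleGraph V) (A B : Set V) :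
    oddNbhd G (A ∆ B) = oddNbhd G A ∆ oddNbhd G B := by
  ext v
  have h := Set.odd_ncard_symmDiff (G.neighborSet v ∩ A) (G.neighborSet v ∩ B)
  rw [← Set.inter_symmDiff_distrib_left] at h
  simp only [oddNbhd, Set.mem_symmDiff, Set.mem_ofPred_eq] at h ⊢
  tauto

theorem oddNbhd_empty {V : Type*} (G : SimpleGraph V) : oddNbhd G ∅ = ∅ := by
  simp [oddNbhd]

theorem Set.odd_ncard_inter_singleton {V : Type*} (A : Set V) (a : V) :
    Odd (A ∩ {a}).ncard ↔ a ∈ A := by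
  by_cases h : a ∈ A
  · rw [Set.inter_eq_right.mpr (Set.singleton_subset_iff.mpr h)]
    simp [h]
  · rw [Set.inter_singleton_eq_empty.mpr h]
    simp [h]

theorem oddNbhd_singleton {V : Type*} (G : SimpleGraph V) (u : V) :
    oddNbhd G {u} = G.neighborSet u := by
  ext v
  simp [oddNbhd, Set.odd_ncard_inter_singleton, G.adj_comm]

theorem localComp_adj {V : Type*} (G : SimpleGraph V) (u x y : V) :
    (localComp G u).Adj x y ↔
      x ≠ y ∧ ¬ ((G.Adj u x ∧ G.Adj u y) ↔ G.Adj x y) := by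
  simp only [localComp, SimpleGraph.fromRel_adj, G.adj_comm y x]
  tauto

theorem neighborSet_localComp_self {V : Type*} (G : SimpleGraph V) (u : V) :
    (localComp G u).neighborSet u = G.neighborSet u := by
  ext v
  have := G.ne_of_adj (a := u) (b := v)
  simp only [SimpleGraph.mem_neighborSet, localComp_adj, SimpleGraph.irrefl]
  tauto

theorem neighborSet_localComp_of_not_adj {V : Type*} {G : SimpleGraph V} {u v : V}
    (h : ¬ G.Adj u v) : (localComp G u).neighborSet v = G.neighborSet v := by
  ext x
  have := G.ne_of_adj (a := v) (b := x)
  simp only [SimpleGraph.mem_neighborSet, localComp_adj]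
  tauto

theorem neighborSet_localComp_of_adj {V : Type*} {G : SimpleGraph V} {u v : V}
    (h : G.Adj u v) : (localComp G u).neighborSet v =
      (G.neighborSet v ∆ G.neighborSet u) ∆ {v} := by
  ext x
  simp only [SimpleGraph.mem_neighborSet, localComp_adj, Set.mem_symmDiff,
    Set.mem_singleton_iff]
  by_cases hx : x = v
  · subst hx
    simp [h]
  · have := Ne.symm hx
    tauto

/-- The effect of local complementation on odd neighbourhoods. -/
theorem mem_oddNbhd_localComp {V : Type*} [Finite V] (G : SimpleGraph V) (u v : V)
    (A : Set V) : v ∈ oddNbhd (localComp G u) A ↔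
      ¬ (v ∈ oddNbhd G A ↔ (G.Adj u v ∧ ¬ (u ∈ oddNbhd G A ↔ v ∈ A))) := by
  by_cases h : G.Adj u v
  · simp only [oddNbhd, Set.mem_ofPred_eq, neighborSet_localComp_of_adj h]
    rw [Set.inter_comm, Set.inter_symmDiff_distrib_left, Set.inter_symmDiff_distrib_left,
      Set.odd_ncard_symmDiff, Set.odd_ncard_symmDiff, Set.odd_ncard_inter_singleton,
      Set.inter_comm A, Set.inter_comm A]
    tauto
  · simp only [oddNbhd, Set.mem_ofPred_eq, neighborSet_localComp_of_not_adj h]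
    tauto

/-- Toggling `u` in `A` if necessary, the odd neighbourhood of `A` changes under local
complementation at `u` only by the neighbours of `u` in `A`. -/
theorem exists_oddNbhd_localComp_eq {V : Type*} [Finite V] (G : SimpleGraph V) (u : V)
    (A : Set V) : ∃ B ⊆ insert u A,
      oddNbhd (localComp G u) B = oddNbhd G A ∆ (G.neighborSet u ∩ A) := by
  by_cases hu : u ∈ oddNbhd G A
  · refine ⟨A ∆ {u}, ?_, ?_⟩
    · intro x
      simp only [Set.mem_symmDiff, Set.mem_singleton_iff, Set.mem_insert_iff]
      tauto
    · rw [oddNbhd_symmDiff, oddNbhd_singleton, neighborSet_localComp_self]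
      ext v
      simp only [Set.mem_symmDiff, mem_oddNbhd_localComp, SimpleGraph.mem_neighborSet,
        Set.mem_inter_iff]
      tauto
  · refine ⟨A, Set.subset_insert u A, ?_⟩
    ext v
    simp only [Set.mem_symmDiff, mem_oddNbhd_localComp, SimpleGraph.mem_neighborSet,
      Set.mem_inter_iff]
    tauto

/-- If every singleton in `F` is the restriction to `K` of an odd neighbourhood of a subset
of `D`, then so is `F`. -/
theorem exists_oddNbhd_inter_eq {V : Type*} [Finite V] (G : SimpleGraph V) (D K F : Set V)
    (h : ∀ v ∈ F, ∃ B ⊆ D, oddNbhd G B ∩ K = {v}) :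
    ∃ B ⊆ D, oddNbhd G B ∩ K = F := by
  induction F, F.toFinite using Set.Finite.induction_on with
  | empty => exact ⟨∅, Set.empty_subset D, by simp [oddNbhd_empty]⟩
  | @insert a F ha _ ih =>
    obtain ⟨B, hB, hBF⟩ := ih fun v hv => h v (Set.mem_insert_of_mem a hv)
    obtain ⟨C, hC, hCa⟩ := h a (Set.mem_insert a F)
    refine ⟨C ∆ B, Set.symmDiff_subset_union.trans (Set.union_subset hC hB), ?_⟩
    rw [oddNbhd_symmDiff, Set.inter_comm, Set.inter_symmDiff_distrib_left, Set.inter_comm K,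
      Set.inter_comm K, hCa, hBF]
    exact (Set.disjoint_singleton_left.mpr ha).symmDiff_eq_sup

/-- Locally complementing at a sink `u ∈ T ∖ S` preserves admittance of a
focused gFlow. -/
theorem localComp_sink_hasFocusedGFlow {V : Type*} [Finite V]
    (G : SimpleGraph V) (S T : Set V) (u : V) (huT : u ∈ T) (huS : u ∉ S)
    (h : HasFocusedGFlow G S T) :
    HasFocusedGFlow (localComp G u) S T := by
  obtain ⟨g, r, hr, hg⟩ := h
  let r' : V → V → Prop := fun x y => x ≠ u ∧ (y = u ∨ r x y)
  have hr' : IsStrictOrder V r' :=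
    { irrefl := fun x hx => hx.2.elim hx.1 (irrefl_of r x)
      trans := fun x y z hxy hyz =>
        ⟨hxy.1, hyz.2.imp_right (trans_of r (hxy.2.resolve_left hyz.1))⟩ }
  suffices H : ∀ w, w ∉ T →
      ∃ B ⊆ Sᶜ ∩ {v | r' w v}, oddNbhd (localComp G u) B ∩ Tᶜ = {w} by
    choose! g' hsub hodd using H
    exact ⟨g', r', hr', fun w hw =>
      ⟨fun v hv => (hsub w hw hv).1, hodd w hw, fun v hv => (hsub w hw hv).2⟩⟩
  have hwf : WellFounded (Function.swap r) := Finite.wellFounded_of_trans_of_irrefl _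
  intro w
  induction w using hwf.induction with
  | _ w ih =>
    intro hw
    obtain ⟨hgS, hgo, hgr⟩ := hg w hw
    have hwu : w ≠ u := fun h => hw (h ▸ huT)
    obtain ⟨A, hA, hAo⟩ := exists_oddNbhd_localComp_eq G u (g w)
    obtain ⟨B, hB, hBo⟩ := exists_oddNbhd_inter_eq (localComp G u) (Sᶜ ∩ {v | r' w v}) Tᶜ
      (G.neighborSet u ∩ g w ∩ Tᶜ) (by
        rintro v ⟨⟨-, hv⟩, hvT⟩
        obtain ⟨B, hB, hBv⟩ := ih v (hgr v hv) hvT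
        exact ⟨B, fun x hx => ⟨(hB hx).1,
          trans_of r' ⟨hwu, Or.inr (hgr v hv)⟩ (hB hx).2⟩, hBv⟩)
    refine ⟨A ∆ B, Set.symmDiff_subset_union.trans (Set.union_subset ?_ hB), ?_⟩
    · intro x hx
      rcases hA hx with rfl | hx
      · exact ⟨huS, hwu, Or.inl rfl⟩
      · exact ⟨hgS hx, hwu, Or.inr (hgr x hx)⟩
    · rw [oddNbhd_symmDiff, hAo, Set.inter_comm, Set.inter_symmDiff_distrib_left,
        Set.inter_symmDiff_distrib_left, Set.inter_comm Tᶜ (oddNbhd G _),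
        Set.inter_comm Tᶜ (oddNbhd _ B), hgo, hBo, Set.inter_comm Tᶜ,
        symmDiff_symmDiff_cancel_right]
end

section
/- Let (G,S,T) be an open graph admitting a focused gFlow in which no two vertices of T are adjacent, and let o₁ and o₂ be distinct vertices of T∖S. Let G' be the graph obtained from G by toggling, for every vertex w adjacent to o₂, the adjacency between o₁ and w, leaving all other adjacencies unchanged (i.e. the new neighbourhood of o₁ is the symmetric difference N_G(o₁) Δ N_G(o₂)). Then the open graph (G',S,T) admits a focused gFlow. -/
/-- The graph obtained from `G` by toggling, for every neighbour `w` of `o₂`,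
the adjacency between `o₁` and `w` (i.e. the new neighbourhood of `o₁` is the
symmetric difference `N_G(o₁) Δ N_G(o₂)`); all other adjacencies are unchanged. -/
def toggleRow {V : Type*} (G : SimpleGraph V) (o₁ o₂ : V) : SimpleGraph V :=
  SimpleGraph.fromRel (fun x y =>
    (x = o₁ ∧ Xor' (G.Adj o₁ y) (G.Adj o₂ y)) ∨
    (x ≠ o₁ ∧ y ≠ o₁ ∧ G.Adj x y))

theorem toggleRow_adj_of_ne {V : Type*} (G : SimpleGraph V) {o₁ o₂ v : V} (hv : v ≠ o₁) (x : V) :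
    (toggleRow G o₁ o₂).Adj v x ↔
      (x = o₁ ∧ ¬(G.Adj v o₁ ↔ G.Adj v o₂)) ∨ (x ≠ o₁ ∧ G.Adj v x) := by
  have hloop : ¬ G.Adj v v := G.irrefl
  have hsymm := G.adj_comm
  have hadj : (toggleRow G o₁ o₂).Adj v x ↔ v ≠ x ∧
      (((v = o₁ ∧ Xor (G.Adj o₁ x) (G.Adj o₂ x)) ∨ (v ≠ o₁ ∧ x ≠ o₁ ∧ G.Adj v x)) ∨
        ((x = o₁ ∧ Xor (G.Adj o₁ v) (G.Adj o₂ v)) ∨ (x ≠ o₁ ∧ v ≠ o₁ ∧ G.Adj x v))) := Iff.rfl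
  grind

open scoped symmDiff in
theorem ncard_symmDiff_add {α : Type*} [Finite α] (s t : Set α) :
    (s ∆ t).ncard + 2 * (s ∩ t).ncard = s.ncard + t.ncard := by
  have hd : Disjoint (s \ t) (t \ s) := disjoint_sdiff_sdiff
  have hu : (s ∆ t).ncard = (s \ t).ncard + (t \ s).ncard := by
    rw [Set.symmDiff_def, Set.ncard_union_eq hd]
  have hs := Set.ncard_inter_add_ncard_sdiff_eq_ncard s t
  have ht := Set.ncard_inter_add_ncard_sdiff_eq_ncard t s
  rw [Set.inter_comm] at ht
  omega

open scoped symmDiff in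
/-- Compensating for a toggle by adding `o₂` to the sets containing `o₁` preserves parities. -/
theorem mem_oddNbhd_toggleRow {V : Type*} [Finite V] (G : SimpleGraph V) {o₁ o₂ v : V}
    (hne : o₁ ≠ o₂) (hv : v ≠ o₁) (A : Set V) :
    v ∈ oddNbhd (toggleRow G o₁ o₂) (A ∆ {x | x = o₂ ∧ o₁ ∈ A}) ↔ v ∈ oddNbhd G A := by
  have hadj := toggleRow_adj_of_ne G (o₂ := o₂) hv
  simp only [oddNbhd, Set.mem_ofPred_eq]
  by_cases h : o₁ ∈ A ∧ G.Adj v o₂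
  · have hset : (toggleRow G o₁ o₂).neighborSet v ∩ (A ∆ {x | x = o₂ ∧ o₁ ∈ A}) =
        (G.neighborSet v ∩ A) ∆ {o₁, o₂} := by
      ext x
      simp only [Set.mem_inter_iff, SimpleGraph.mem_neighborSet, Set.mem_symmDiff, hadj,
        Set.mem_ofPred_eq, Set.mem_insert_iff, Set.mem_singleton_iff]
      grind
    have hcard := ncard_symmDiff_add (G.neighborSet v ∩ A) {o₁, o₂}
    rw [Set.ncard_pair hne] at hcard
    rw [hset, Nat.odd_iff, Nat.odd_iff]
    omega
  · have hset : (toggleRow G o₁ o₂).neighborSet v ∩ (A ∆ {x | x = o₂ ∧ o₁ ∈ A}) =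
        G.neighborSet v ∩ A := by
      ext x
      simp only [Set.mem_inter_iff, SimpleGraph.mem_neighborSet, Set.mem_symmDiff, hadj,
        Set.mem_ofPred_eq]
      grind
    rw [hset]

/-- In an open graph with a focused gFlow in which no two sinks are adjacent, replacing
the neighbourhood of a sink `o₁ ∈ T ∖ S` by its symmetric difference with the
neighbourhood of another sink `o₂ ∈ T ∖ S` preserves admittance of a focused gFlow. -/
theorem toggleRow_hasFocusedGFlow {V : Type*} [Finite V]
    (G : SimpleGraph V) (S T : Set V)
    (hT : ∀ x ∈ T, ∀ y ∈ T, ¬ G.Adj x y)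
    (o₁ o₂ : V) (h₁T : o₁ ∈ T) (h₁S : o₁ ∉ S) (h₂T : o₂ ∈ T) (h₂S : o₂ ∉ S)
    (hne : o₁ ≠ o₂)
    (h : HasFocusedGFlow G S T) :
    HasFocusedGFlow (toggleRow G o₁ o₂) S T := by
  obtain ⟨g, r, hr, hg⟩ := h
  refine ⟨fun u => symmDiff (g u) {x | x = o₂ ∧ o₁ ∈ g u},
    fun x y => x ∉ T ∧ (y ∈ T ∨ r x y), ?_, fun u hu => ?_⟩
  · exact
      { irrefl := fun x hx => hx.2.elim hx.1 (hr.irrefl x)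
        trans := fun x y z hxy hyz =>
          ⟨hxy.1, hyz.2.imp_right fun h => hr.trans x y z (hxy.2.resolve_left hyz.1) h⟩ }
  obtain ⟨hS, hodd, hlt⟩ := hg u hu
  refine ⟨?_, ?_, ?_⟩
  · rintro x (⟨hx, -⟩ | ⟨⟨rfl, -⟩, -⟩)
    · exact hS hx
    · exact h₂S
  · rw [← hodd]
    ext v
    refine and_congr_left fun hv => mem_oddNbhd_toggleRow G hne ?_ _
    rintro rfl
    exact hv h₁T
  · rintro x (⟨hx, -⟩ | ⟨⟨rfl, -⟩, -⟩)
    · exact ⟨hu, Or.inr (hlt x hx)⟩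
    · exact ⟨hu, Or.inl h₂T⟩
end

section
/- For all labels A, B in 𝓛, the interpretation of the greatest lower bound of A and B equals the intersection of their interpretations: ⟦A ⊓ B⟧ = ⟦A⟧ ∩ ⟦B⟧. -/
open scoped ComplexOrder

/-- The classicalization labels 𝓛 = {Q, X, Y, Z, ⊥}. -/
inductive Lbl : Type
  | Q | X | Y | Z | Bot
  deriving DecidableEq

/-- The greatest lower bound for the label order in which `Q` is the top element,
`⊥` is the bottom element, and `X`, `Y`, `Z` are pairwise incomparable. -/
def Lbl.inf (a b : Lbl) : Lbl :=
  if a = b then a else if a = .Q then b else if b = .Q then a else .Bot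

/-- The interpretation of each label as a set of 2×2 complex density matrices. -/
def interp : Lbl → Set (Matrix (Fin 2) (Fin 2) ℂ)
  | .Q => {ρ | ρ.PosSemidef ∧ ρ.trace = 1}
  | .Z => {ρ | ∃ a b : ℝ, 0 ≤ a ∧ 0 ≤ b ∧ a + b = 1 ∧
      ρ = (a : ℂ) • !![1, 0; 0, 0] + (b : ℂ) • !![0, 0; 0, 1]}
  | .X => {ρ | ∃ a b : ℝ, 0 ≤ a ∧ 0 ≤ b ∧ a + b = 1 ∧
      ρ = (a : ℂ) • ((1/2 : ℂ) • !![1, 1; 1, 1]) +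
          (b : ℂ) • ((1/2 : ℂ) • !![1, -1; -1, 1])}
  | .Y => {ρ | ∃ a b : ℝ, 0 ≤ a ∧ 0 ≤ b ∧ a + b = 1 ∧
      ρ = (a : ℂ) • ((1/2 : ℂ) • !![1, -Complex.I; Complex.I, 1]) +
          (b : ℂ) • ((1/2 : ℂ) • !![1, Complex.I; -Complex.I, 1])}
  | .Bot => {(1/2 : ℂ) • (1 : Matrix (Fin 2) (Fin 2) ℂ)}

theorem posSemidef_of_isHermitian_of_isIdempotentElem {n : Type*} [Fintype n]
    {P : Matrix n n ℂ} (hP : P.IsHermitian) (h : P * P = P) : P.PosSemidef := by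
  have := Matrix.posSemidef_conjTranspose_mul_self P
  rwa [hP.eq, h] at this

theorem convexCombination_mem_interp_Q {a b : ℝ} (ha : 0 ≤ a) (hb : 0 ≤ b) (hab : a + b = 1)
    {P R : Matrix (Fin 2) (Fin 2) ℂ} (hP : P.IsHermitian) (hPP : P * P = P) (hP1 : P.trace = 1)
    (hR : R.IsHermitian) (hRR : R * R = R) (hR1 : R.trace = 1) :
    (a : ℂ) • P + (b : ℂ) • R ∈ interp .Q := by
  refine ⟨((posSemidef_of_isHermitian_of_isIdempotentElem hP hPP).smul ?_).add
    ((posSemidef_of_isHermitian_of_isIdempotentElem hR hRR).smul ?_), ?_⟩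
  · exact_mod_cast ha
  · exact_mod_cast hb
  · rw [Matrix.trace_add, Matrix.trace_smul, Matrix.trace_smul, hP1, hR1]
    simpa using mod_cast hab

theorem interp_Z_subset_Q : interp .Z ⊆ interp .Q := by
  rintro ρ ⟨a, b, ha, hb, hab, rfl⟩
  apply convexCombination_mem_interp_Q ha hb hab
  case hP1 | hR1 => simp [Matrix.trace_fin_two]
  all_goals
    ext i j
    fin_cases i <;> fin_cases j <;> simp

theorem interp_Bot_subset (A : Lbl) : interp .Bot ⊆ interp A := by
  have hZ : interp .Bot ⊆ interp .Z := by
    rintro ρ rfl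
    refine ⟨1 / 2, 1 / 2, by norm_num, by norm_num, by norm_num, ?_⟩
    ext i j
    fin_cases i <;> fin_cases j <;> simp
  cases A with
  | Q => exact hZ.trans interp_Z_subset_Q
  | Z => exact hZ
  | Bot => exact subset_rfl
  | X | Y =>
    rintro ρ rfl
    refine ⟨1 / 2, 1 / 2, by norm_num, by norm_num, by norm_num, ?_⟩
    ext i j
    fin_cases i <;> fin_cases j <;> simp <;> norm_num

theorem interp_subset_Q (A : Lbl) : interp A ⊆ interp .Q := by
  cases A with
  | Q => exact subset_rfl
  | Bot => exact interp_Bot_subset .Q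
  | Z => exact interp_Z_subset_Q
  | X | Y =>
    rintro ρ ⟨a, b, ha, hb, hab, rfl⟩
    apply convexCombination_mem_interp_Q ha hb hab
    case hP1 | hR1 =>
      simp [Matrix.trace_fin_two]
      try norm_num
    all_goals
      ext i j
      fin_cases i <;> fin_cases j <;> simp [Complex.ext_iff] <;> norm_num

theorem mem_interp_Bot_of_entries {ρ : Matrix (Fin 2) (Fin 2) ℂ} (h00 : ρ 0 0 = 1 / 2)
    (h11 : ρ 1 1 = 1 / 2) (h01 : ρ 0 1 = 0) (h10 : ρ 1 0 = 0) : ρ ∈ interp .Bot := by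
  change ρ = _
  ext i j
  fin_cases i <;> fin_cases j <;> simp [h00, h11, h01, h10]

theorem entries_of_mem_interp_X {ρ : Matrix (Fin 2) (Fin 2) ℂ} (h : ρ ∈ interp .X) :
    ρ 0 0 = 1 / 2 ∧ ρ 1 1 = 1 / 2 ∧ (ρ 0 1).im = 0 ∧ ρ 1 0 = ρ 0 1 := by
  obtain ⟨a, b, -, -, hab, rfl⟩ := h
  have hab' : (a : ℂ) + b = 1 := mod_cast hab
  refine ⟨?_, ?_, ?_, ?_⟩ <;> simp
  all_goals linear_combination hab' / 2

theorem entries_of_mem_interp_Y {ρ : Matrix (Fin 2) (Fin 2) ℂ} (h : ρ ∈ interp .Y) :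
    ρ 0 0 = 1 / 2 ∧ ρ 1 1 = 1 / 2 ∧ (ρ 0 1).re = 0 ∧ ρ 1 0 = -ρ 0 1 := by
  obtain ⟨a, b, -, -, hab, rfl⟩ := h
  have hab' : (a : ℂ) + b = 1 := mod_cast hab
  refine ⟨?_, ?_, ?_, ?_⟩ <;> simp
  · linear_combination hab' / 2
  · linear_combination hab' / 2
  · ring

theorem entries_of_mem_interp_Z {ρ : Matrix (Fin 2) (Fin 2) ℂ} (h : ρ ∈ interp .Z) :
    ρ 0 1 = 0 ∧ ρ 1 0 = 0 := by
  obtain ⟨a, b, -, -, -, rfl⟩ := h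
  simp

theorem interp_X_inter_Y : interp .X ∩ interp .Y = interp .Bot := by
  refine Set.Subset.antisymm ?_
    (Set.subset_inter (interp_Bot_subset _) (interp_Bot_subset _))
  rintro ρ ⟨hX, hY⟩
  obtain ⟨h00, h11, him, h10⟩ := entries_of_mem_interp_X hX
  obtain ⟨-, -, hre, -⟩ := entries_of_mem_interp_Y hY
  have h01 : ρ 0 1 = 0 := Complex.ext hre him
  exact mem_interp_Bot_of_entries h00 h11 h01 (h10.trans h01)

theorem interp_X_inter_Z : interp .X ∩ interp .Z = interp .Bot := by
  refine Set.Subset.antisymm ?_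
    (Set.subset_inter (interp_Bot_subset _) (interp_Bot_subset _))
  rintro ρ ⟨hX, hZ⟩
  obtain ⟨h00, h11, -, -⟩ := entries_of_mem_interp_X hX
  obtain ⟨h01, h10⟩ := entries_of_mem_interp_Z hZ
  exact mem_interp_Bot_of_entries h00 h11 h01 h10

theorem interp_Y_inter_Z : interp .Y ∩ interp .Z = interp .Bot := by
  refine Set.Subset.antisymm ?_
    (Set.subset_inter (interp_Bot_subset _) (interp_Bot_subset _))
  rintro ρ ⟨hY, hZ⟩
  obtain ⟨h00, h11, -, -⟩ := entries_of_mem_interp_Y hY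
  obtain ⟨h01, h10⟩ := entries_of_mem_interp_Z hZ
  exact mem_interp_Bot_of_entries h00 h11 h01 h10

/-- The interpretation of the greatest lower bound of two labels is the intersection
of their interpretations. -/
theorem interp_inf (A B : Lbl) : interp (Lbl.inf A B) = interp A ∩ interp B := by
  cases A <;> cases B <;>
    simp only [Lbl.inf, reduceCtorEq, if_true, if_false, Set.inter_self, interp_X_inter_Y,
      interp_X_inter_Z, interp_Y_inter_Z, Set.inter_comm (interp .Y) (interp .X),
      Set.inter_comm (interp .Z) (interp .X), Set.inter_comm (interp .Z) (interp .Y),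
      Set.inter_eq_left.2 (interp_subset_Q _), Set.inter_eq_right.2 (interp_subset_Q _),
      Set.inter_eq_left.2 (interp_Bot_subset _), Set.inter_eq_right.2 (interp_Bot_subset _)]
end

section
/- For every α ∈ [0,2π) and all labels A, B in 𝓛, one has rot_α(A ⋆ B) ≤ rot_α(A) ⋆ B in the label order. -/
/-- The binary operation ⋆ on labels. -/
def Lbl.star : Lbl → Lbl → Lbl
  | .Z, _ => .Z
  | _, .Z => .Z
  | .X, a => a
  | a, .X => a
  | .Y, .Y => .X
  | .Y, .Q => .Q
  | .Q, .Y => .Q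
  | .Y, .Bot => .Bot
  | .Bot, .Y => .Bot
  | .Q, .Q => .Q
  | .Q, .Bot => .Z
  | .Bot, .Q => .Z
  | .Bot, .Bot => .Bot

/-- The label order: `Q` is the top element, `⊥` is the bottom element, and
`X`, `Y`, `Z` are pairwise incomparable. -/
def Lbl.le (a b : Lbl) : Prop := a = b ∨ a = .Bot ∨ b = .Q

/-- The rotation map `rot_α` on labels, for `α ∈ [0, 2π)`. -/
noncomputable def Lbl.rot (α : ℝ) : Lbl → Lbl
  | .Q => .Q
  | .Z => .Z
  | .Bot => .Bot
  | .X =>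
      if α = 0 ∨ α = Real.pi then .X
      else if α = Real.pi / 2 ∨ α = 3 * Real.pi / 2 then .Y
      else .Q
  | .Y =>
      if α = 0 ∨ α = Real.pi then .Y
      else if α = Real.pi / 2 ∨ α = 3 * Real.pi / 2 then .X
      else .Q

/-- For every `α ∈ [0, 2π)` and all labels `A`, `B`:
`rot_α(A ⋆ B) ≤ rot_α(A) ⋆ B` in the label order. -/
theorem rot_star_le (α : ℝ) (hα₀ : 0 ≤ α) (hα₁ : α < 2 * Real.pi) (A B : Lbl) :
    Lbl.le (Lbl.rot α (Lbl.star A B)) (Lbl.star (Lbl.rot α A) B) := by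
  cases A <;> cases B <;> simp only [Lbl.star, Lbl.rot, Lbl.le] <;>
    (try split_ifs) <;> simp
end

section
/- For every label A in 𝓛 and every matrix a ∈ ⟦A⟧, the matrix H a H† belongs to ⟦h(A)⟧, where H = (1/√2)·[[1,1],[1,−1]] is the Hadamard matrix and H† its conjugate transpose. -/
open scoped ComplexOrder Matrix

/-- The map `h` on labels: it fixes `Q`, `Y` and `⊥` and exchanges `X` and `Z`. -/
def Lbl.hmap : Lbl → Lbl
  | .Q => .Q
  | .Y => .Y
  | .Bot => .Bot
  | .X => .Z
  | .Z => .X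

/-- The Hadamard matrix `H = (1/√2)·[[1,1],[1,−1]]`. -/
noncomputable def Hmat : Matrix (Fin 2) (Fin 2) ℂ :=
  ((Real.sqrt 2 : ℂ))⁻¹ • !![1, 1; 1, -1]

/-- Entrywise formula for conjugation by the Hadamard matrix. -/
lemma Hmat_mul_mul_conjTranspose (p q r s : ℂ) :
    Hmat * !![p, q; r, s] * Hmatᴴ =
      (1 / 2 : ℂ) • !![p + q + r + s, p - q + r - s; p + q - r - s, p - q - r + s] := by
  have h : ((Real.sqrt 2 : ℂ))⁻¹ * ((Real.sqrt 2 : ℂ))⁻¹ = 1 / 2 := by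
    rw [← mul_inv, ← Complex.ofReal_mul, Real.mul_self_sqrt zero_le_two]
    norm_num
  rw [← h]
  ext i j
  fin_cases i <;> fin_cases j <;>
    simp [Hmat, Matrix.mul_apply, Fin.sum_univ_two] <;> ring

/-- For every label `A` and every `a ∈ ⟦A⟧`, the matrix `H a H†` belongs to `⟦h(A)⟧`. -/
theorem hadamard_conj_interp (A : Lbl) (a : Matrix (Fin 2) (Fin 2) ℂ)
    (ha : a ∈ interp A) : Hmat * a * Hmatᴴ ∈ interp (Lbl.hmap A) := by
  cases A with
  | Q =>
    obtain ⟨hpos, htr⟩ := ha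
    refine ⟨hpos.mul_mul_conjTranspose_same Hmat, ?_⟩
    rw [Matrix.trace_fin_two] at htr
    rw [Matrix.eta_fin_two a, Hmat_mul_mul_conjTranspose, Matrix.trace_fin_two]
    simp only [Matrix.smul_apply, Matrix.of_apply, Matrix.cons_val', Matrix.cons_val_zero,
      Matrix.cons_val_one, Matrix.cons_val_fin_one, smul_eq_mul]
    linear_combination htr
  | X =>
    obtain ⟨x, y, hx, hy, hxy, rfl⟩ := ha
    refine ⟨x, y, hx, hy, hxy, ?_⟩
    rw [Matrix.eta_fin_two (_ + _), Hmat_mul_mul_conjTranspose]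
    ext i j
    fin_cases i <;> fin_cases j <;> simp <;> ring
  | Y =>
    obtain ⟨x, y, hx, hy, hxy, rfl⟩ := ha
    refine ⟨y, x, hy, hx, add_comm y x ▸ hxy, ?_⟩
    rw [Matrix.eta_fin_two (_ + _), Hmat_mul_mul_conjTranspose]
    ext i j
    fin_cases i <;> fin_cases j <;> simp <;> ring
  | Z =>
    obtain ⟨x, y, hx, hy, hxy, rfl⟩ := ha
    refine ⟨x, y, hx, hy, hxy, ?_⟩
    rw [Matrix.eta_fin_two (_ + _), Hmat_mul_mul_conjTranspose]
    ext i j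
    fin_cases i <;> fin_cases j <;> simp <;> ring
  | Bot =>
    obtain rfl : a = (1 / 2 : ℂ) • (1 : Matrix (Fin 2) (Fin 2) ℂ) := ha
    change _ = (1 / 2 : ℂ) • (1 : Matrix (Fin 2) (Fin 2) ℂ)
    rw [Matrix.eta_fin_two (_ • _), Hmat_mul_mul_conjTranspose]
    ext i j
    fin_cases i <;> fin_cases j <;> simp <;> ring
end

section
/- For every α ∈ [0,2π), every label A in 𝓛 and every matrix a ∈ ⟦A⟧, the matrix U_α a U_α† belongs to ⟦rot_α(A)⟧, where U_α = [[1,0],[0,e^{iα}]] and U_α† is its conjugate transpose. -/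
open scoped ComplexOrder Matrix

/-- The phase matrix `U_α = [[1,0],[0,e^{iα}]]`. -/
noncomputable def Umat (α : ℝ) : Matrix (Fin 2) (Fin 2) ℂ :=
  !![1, 0; 0, Complex.exp (Complex.I * α)]

theorem Umat_conj (α : ℝ) (p q r s : ℂ) :
    Umat α * !![p, q; r, s] * (Umat α)ᴴ =
      !![p, q * star (Complex.exp (Complex.I * α)); Complex.exp (Complex.I * α) * r, s] := by
  have h : Complex.exp (Complex.I * α) * star (Complex.exp (Complex.I * α)) = 1 := by
    rw [Complex.star_def, ← Complex.exp_conj, ← Complex.exp_add]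
    simp
  ext i j
  fin_cases i <;> fin_cases j <;> simp [Umat, Matrix.mul_apply, Fin.sum_univ_two] at h ⊢
  linear_combination s * h

theorem conjTranspose_Umat_mul_self (α : ℝ) : (Umat α)ᴴ * Umat α = 1 := by
  have h := Umat_conj α 1 0 0 1
  rw [← Matrix.one_fin_two, mul_one, zero_mul, mul_zero, ← Matrix.one_fin_two] at h
  exact mul_eq_one_comm.mp h

theorem Umat_conj_mem_interp_Q (α : ℝ) {a : Matrix (Fin 2) (Fin 2) ℂ} (ha : a ∈ interp .Q) :
    Umat α * a * (Umat α)ᴴ ∈ interp .Q := by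
  refine ⟨ha.1.mul_mul_conjTranspose_same _, ?_⟩
  rw [Matrix.trace_mul_cycle, conjTranspose_Umat_mul_self, one_mul]
  exact ha.2

theorem posSemidef_phase (u : ℂ) (hu : u * star u = 1) :
    ((1 / 2 : ℂ) • !![1, star u; u, 1]).PosSemidef := by
  have h : !![1, star u; u, 1] = Matrix.vecMulVec ![1, u] (star ![1, u]) := by
    ext i j
    fin_cases i <;> fin_cases j <;> simp_all [Matrix.vecMulVec_apply]
  rw [h]
  exact (Matrix.posSemidef_vecMulVec_self_star _).smul (by norm_num [Complex.le_def])

theorem interp_X_subset_Q : interp .X ⊆ interp .Q := by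
  rintro _ ⟨a, b, ha, hb, hab, rfl⟩
  have h₁ := posSemidef_phase 1 (by simp)
  have h₂ := posSemidef_phase (-1) (by simp)
  simp only [star_neg, star_one] at h₁ h₂
  refine ⟨(h₁.smul (Complex.zero_le_real.mpr ha)).add (h₂.smul (Complex.zero_le_real.mpr hb)), ?_⟩
  have : (a : ℂ) + b = 1 := by exact_mod_cast hab
  simp [Matrix.trace_fin_two]
  linear_combination this

theorem interp_Y_subset_Q : interp .Y ⊆ interp .Q := by
  rintro _ ⟨a, b, ha, hb, hab, rfl⟩
  have h₁ := posSemidef_phase Complex.I (by simp)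
  have h₂ := posSemidef_phase (-Complex.I) (by simp)
  simp only [star_neg, Complex.star_def, Complex.conj_I, neg_neg] at h₁ h₂
  refine ⟨(h₁.smul (Complex.zero_le_real.mpr ha)).add (h₂.smul (Complex.zero_le_real.mpr hb)), ?_⟩
  have : (a : ℂ) + b = 1 := by exact_mod_cast hab
  simp [Matrix.trace_fin_two]
  linear_combination this

theorem exp_I_mul_pi_div_two : Complex.exp (Complex.I * (Real.pi / 2 : ℝ)) = Complex.I := by
  rw [mul_comm]
  push_cast
  exact Complex.exp_pi_div_two_mul_I

theorem exp_I_mul_three_pi_div_two :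
    Complex.exp (Complex.I * (3 * Real.pi / 2 : ℝ)) = -Complex.I := by
  have h : Complex.I * (3 * Real.pi / 2 : ℝ) =
      Real.pi * Complex.I + Real.pi / 2 * Complex.I := by
    push_cast
    ring
  rw [h, Complex.exp_add, Complex.exp_pi_mul_I, Complex.exp_pi_div_two_mul_I, neg_one_mul]

theorem exp_I_mul_pi : Complex.exp (Complex.I * Real.pi) = -1 := by
  rw [mul_comm, Complex.exp_pi_mul_I]

/-- For every `α ∈ [0, 2π)`, every label `A` and every `a ∈ ⟦A⟧`, the matrix
`U_α a U_α†` belongs to `⟦rot_α(A)⟧`. -/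
theorem phase_conj_interp (α : ℝ) (hα₀ : 0 ≤ α) (hα₁ : α < 2 * Real.pi)
    (A : Lbl) (a : Matrix (Fin 2) (Fin 2) ℂ) (ha : a ∈ interp A) :
    Umat α * a * (Umat α)ᴴ ∈ interp (Lbl.rot α A) := by
  cases A with
  | Q => exact Umat_conj_mem_interp_Q α ha
  | Z =>
    obtain ⟨p, q, hp, hq, hpq, rfl⟩ := ha
    refine ⟨p, q, hp, hq, hpq, ?_⟩
    simp [Umat_conj]
  | Bot =>
    obtain rfl : a = _ := ha
    change _ = _
    rw [Matrix.mul_smul, Matrix.smul_mul, mul_one,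
      mul_eq_one_comm.mp (conjTranspose_Umat_mul_self α)]
  | X =>
    simp only [Lbl.rot]
    split_ifs with h₁ h₂
    · obtain ⟨p, q, hp, hq, hpq, rfl⟩ := ha
      rcases h₁ with rfl | rfl
      · refine ⟨p, q, hp, hq, hpq, ?_⟩
        simp [mul_add, Umat_conj]
      · refine ⟨q, p, hq, hp, by rwa [add_comm], ?_⟩
        simp only [mul_add, add_mul, Matrix.mul_smul, Matrix.smul_mul, Umat_conj, exp_I_mul_pi]
        simp [add_comm]
    · obtain ⟨p, q, hp, hq, hpq, rfl⟩ := ha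
      rcases h₂ with rfl | rfl
      · refine ⟨p, q, hp, hq, hpq, ?_⟩
        simp only [mul_add, add_mul, Matrix.mul_smul, Matrix.smul_mul, Umat_conj,
          exp_I_mul_pi_div_two]
        simp
      · refine ⟨q, p, hq, hp, by rwa [add_comm], ?_⟩
        simp only [mul_add, add_mul, Matrix.mul_smul, Matrix.smul_mul, Umat_conj,
          exp_I_mul_three_pi_div_two]
        simp [add_comm]
    · exact Umat_conj_mem_interp_Q α (interp_X_subset_Q ha)
  | Y =>
    simp only [Lbl.rot]
    split_ifs with h₁ h₂
    · obtain ⟨p, q, hp, hq, hpq, rfl⟩ := ha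
      rcases h₁ with rfl | rfl
      · refine ⟨p, q, hp, hq, hpq, ?_⟩
        simp [mul_add, Umat_conj]
      · refine ⟨q, p, hq, hp, by rwa [add_comm], ?_⟩
        simp only [mul_add, add_mul, Matrix.mul_smul, Matrix.smul_mul, Umat_conj, exp_I_mul_pi]
        simp [add_comm]
    · obtain ⟨p, q, hp, hq, hpq, rfl⟩ := ha
      rcases h₂ with rfl | rfl
      · refine ⟨q, p, hq, hp, by rwa [add_comm], ?_⟩
        simp only [mul_add, add_mul, Matrix.mul_smul, Matrix.smul_mul, Umat_conj,
          exp_I_mul_pi_div_two]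
        simp [add_comm]
      · refine ⟨p, q, hp, hq, hpq, ?_⟩
        simp only [mul_add, add_mul, Matrix.mul_smul, Matrix.smul_mul, Umat_conj,
          exp_I_mul_three_pi_div_two]
        simp
    · exact Umat_conj_mem_interp_Q α (interp_Y_subset_Q ha)
end
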